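/- (Hierarchical variant of the factorization lemma.) Let 𝕂 be ℝ or ℂ. View 𝕂^{N·n} as N inner blocks of size n, and call v ∈ 𝕂^{N·n} (s₂,σ)-sparse if at most s₂ of its inner blocks are nonzero and each inner block is σ-sparse. Let A ∈ 𝕂^{m×(N·n)} satisfy |‖A v‖² − ‖v‖²| ≤ δ ‖v‖² for every (s₂,σ)-sparse v ∈ 𝕂^{N·n} (i.e. A has (s₂,σ)-HiRIP constant at most δ). Let U ∈ 𝕂^{μ×m}, Q = U A, H(w) = Σ_{k ∈ ZMod μ} S_k (Q w_k) for block vectors w : ZMod μ → 𝕂^{N·n}, and Ĥ(v) = Σ_{k ∈ ZMod μ} S_k (U v_k). Call a block vector w : ZMod μ → 𝕂^{N·n} (s,s₂,σ)-sparse if at most s of its blocks w_k are nonzero and each block w_k is (s₂,σ)-sparse. Suppose Δ ≥ 0 satisfies |‖Ĥ(A w)‖² − ‖A w‖²| ≤ Δ ‖A w‖² for every (s,s₂,σ)-sparse block vector w (A w being the blockwise application). Then for every (s,s₂,σ)-sparse block vector w : ZMod μ → 𝕂^{N·n}, |‖H(w)‖² − ‖w‖²| ≤ (Δ + δ + Δ·δ)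 ‖w‖². -/

import Mathlib

open Finset

/-- Squared Euclidean norm of a vector: `‖x‖² = Σ_i ‖x_i‖²`. -/
noncomputable def sqNorm {𝕂 : Type*} [RCLike 𝕂] {ι : Type*} [Fintype ι]
    (x : ι → 𝕂) : ℝ :=
  ∑ i, ‖x i‖ ^ 2

/-- Squared norm of a block vector: `‖w‖² = Σ_k ‖w_k‖²`. -/
noncomputable def blockSqNorm {𝕂 : Type*} [RCLike 𝕂] {μ : ℕ} [NeZero μ]
    {ι : Type*} [Fintype ι] (w : ZMod μ → ι → 𝕂) : ℝ :=
  ∑ k : ZMod μ, sqNorm (w k)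

/-- A vector is `σ`-sparse if its support has at most `σ` elements. -/
def SparseVec {𝕂 : Type*} [RCLike 𝕂] {ι : Type*} (σ : ℕ) (x : ι → 𝕂) : Prop :=
  Set.ncard {i | x i ≠ 0} ≤ σ

/-- A vector in `𝕂^{N·n}`, viewed as `N` inner blocks of size `n` (indexed by
`Fin N × Fin n`), is `(s₂,σ)`-sparse if at most `s₂` of its inner blocks are
nonzero and each inner block is `σ`-sparse. -/
def InnerHiSparse {𝕂 : Type*} [RCLike 𝕂] {N n : ℕ} (s₂ σ : ℕ)
    (v : Fin N × Fin n → 𝕂) : Prop :=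
  Set.ncard {j : Fin N | (fun i => v (j, i)) ≠ 0} ≤ s₂ ∧
    ∀ j : Fin N, SparseVec σ (fun i => v (j, i))

/-- A block vector `w : ZMod μ → 𝕂^{N·n}` is `(s,s₂,σ)`-sparse if at most `s`
of its blocks are nonzero and each block is `(s₂,σ)`-sparse. -/
def HiSparse3 {𝕂 : Type*} [RCLike 𝕂] {μ N n : ℕ} (s s₂ σ : ℕ)
    (w : ZMod μ → Fin N × Fin n → 𝕂) : Prop :=
  Set.ncard {k | w k ≠ 0} ≤ s ∧ ∀ k, InnerHiSparse s₂ σ (w k)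

/-- The shift operator `S_ℓ`: `(S_ℓ x)_k = x_{k+ℓ}`. -/
def shiftOp {𝕂 : Type*} [RCLike 𝕂] {μ : ℕ} (ℓ : ZMod μ) (x : ZMod μ → 𝕂) :
    ZMod μ → 𝕂 :=
  fun k => x (k + ℓ)

/-- The lifted operator associated with a matrix `M`: `w ↦ Σ_k S_k (M w_k)`. -/
noncomputable def liftedOp {𝕂 : Type*} [RCLike 𝕂] {μ : ℕ} [NeZero μ]
    {ι : Type*} [Fintype ι] (M : Matrix (ZMod μ) ι 𝕂)
    (w : ZMod μ → ι → 𝕂) : ZMod μ → 𝕂 :=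
  ∑ k : ZMod μ, shiftOp k (M.mulVec (w k))

/-- Blockwise application of a matrix `A` to a block vector: `(A w)_k = A w_k`. -/
def blockApply {𝕂 : Type*} [RCLike 𝕂] {μ m : ℕ} {ι : Type*} [Fintype ι]
    (A : Matrix (Fin m) ι 𝕂) (w : ZMod μ → ι → 𝕂) :
    ZMod μ → Fin m → 𝕂 :=
  fun k => A.mulVec (w k)

theorem liftedOp_mul {𝕂 : Type*} [RCLike 𝕂] {μ m : ℕ} [NeZero μ] {ι : Type*} [Fintype ι]
    (U : Matrix (ZMod μ) (Fin m) 𝕂) (A : Matrix (Fin m) ι 𝕂) (w : ZMod μ → ι → 𝕂) :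
    liftedOp (U * A) w = liftedOp U (blockApply A w) := by
  simp only [liftedOp, blockApply, Matrix.mulVec_mulVec]

/-- A blockwise norm distortion bound for `A` sums to a bound on the block vector. -/
theorem abs_blockSqNorm_blockApply_sub_le {𝕂 : Type*} [RCLike 𝕂] {μ m : ℕ} [NeZero μ]
    {ι : Type*} [Fintype ι] (A : Matrix (Fin m) ι 𝕂) {δ : ℝ} (w : ZMod μ → ι → 𝕂)
    (h : ∀ k, |sqNorm (A.mulVec (w k)) - sqNorm (w k)| ≤ δ * sqNorm (w k)) :
    |blockSqNorm (blockApply A w) - blockSqNorm w| ≤ δ * blockSqNorm w := by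
  simp only [blockSqNorm, blockApply, ← Finset.sum_sub_distrib, Finset.mul_sum]
  exact (Finset.abs_sum_le_sum_abs _ _).trans (Finset.sum_le_sum fun k _ => h k)

/-- Hierarchical variant of the factorization lemma: if the
compression matrix `A` has `(s₂,σ)`-HiRIP constant at most `δ` and `Ĥ` built
from `U` satisfies the restricted bound `Δ` on images under blockwise `A` of
`(s,s₂,σ)`-sparse block vectors, then the lifted operator `H` built from
`Q = U A` satisfies `|‖H(w)‖² − ‖w‖²| ≤ (Δ + δ + Δ·δ) ‖w‖²` for every
`(s,s₂,σ)`-sparse block vector `w`. -/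
theorem hierarchical_factorization_lemma {𝕂 : Type*} [RCLike 𝕂]
    {μ m N n : ℕ} [NeZero μ]
    (U : Matrix (ZMod μ) (Fin m) 𝕂) (A : Matrix (Fin m) (Fin N × Fin n) 𝕂)
    (s s₂ σ : ℕ) (Δ δ : ℝ) (hΔ : 0 ≤ Δ) (hδ : 0 ≤ δ)
    (hA : ∀ v : Fin N × Fin n → 𝕂, InnerHiSparse s₂ σ v →
      |sqNorm (A.mulVec v) - sqNorm v| ≤ δ * sqNorm v)
    (hU : ∀ w : ZMod μ → Fin N × Fin n → 𝕂, HiSparse3 s s₂ σ w →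
      |sqNorm (liftedOp U (blockApply A w)) - blockSqNorm (blockApply A w)| ≤
        Δ * blockSqNorm (blockApply A w)) :
    ∀ w : ZMod μ → Fin N × Fin n → 𝕂, HiSparse3 s s₂ σ w →
      |sqNorm (liftedOp (U * A) w) - blockSqNorm w| ≤
        (Δ + δ + Δ * δ) * blockSqNorm w := by
  intro w hw
  have hAw := abs_blockSqNorm_blockApply_sub_le A w fun k => hA _ (hw.2 k)
  have hUw := hU w hw
  rw [liftedOp_mul]
  have hmul : Δ * blockSqNorm (blockApply A w) ≤ Δ * ((1 + δ) * blockSqNorm w) :=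
    mul_le_mul_of_nonneg_left (by linarith [(abs_le.mp hAw).2]) hΔ
  calc |sqNorm (liftedOp U (blockApply A w)) - blockSqNorm w|
      ≤ |sqNorm (liftedOp U (blockApply A w)) - blockSqNorm (blockApply A w)| +
          |blockSqNorm (blockApply A w) - blockSqNorm w| := abs_sub_le _ _ _
    _ ≤ Δ * ((1 + δ) * blockSqNorm w) + δ * blockSqNorm w :=
        add_le_add (hUw.trans hmul) hAw
    _ = (Δ + δ + Δ * δ) * blockSqNorm w := by ring
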